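/- arXiv:2107.03767 — 5 statements merged into one kernel-verified Lean document; each statement's English description precedes it below -/
import Mathlib

section
/- For every curvature parameter c > 0 and every natural number n, the Poincaré ball is closed under Möbius addition: if u, v ∈ ℝⁿ satisfy c‖u‖² < 1 and c‖v‖² < 1, then c‖u ⊕_c v‖² < 1. -/
open scoped RealInnerProductSpace

/-- Möbius addition on the Poincaré ball with curvature parameter `c`. -/
noncomputable def mobiusAdd {n : ℕ} (c : ℝ) (u v : EuclideanSpace ℝ (Fin n)) :
    EuclideanSpace ℝ (Fin n) :=
  (1 + 2 * c * ⟪u, v⟫ + c ^ 2 * ‖u‖ ^ 2 * ‖v‖ ^ 2)⁻¹ •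
    ((1 + 2 * c * ⟪u, v⟫ + c * ‖v‖ ^ 2) • u + (1 - c * ‖u‖ ^ 2) • v)

/-- Real inverse hyperbolic tangent. -/
noncomputable def arctanh (x : ℝ) : ℝ := (1 / 2) * Real.log ((1 + x) / (1 - x))

/-- Hyperbolic distance on the Poincaré ball of curvature `-c`. -/
noncomputable def hypDist {n : ℕ} (c : ℝ) (u v : EuclideanSpace ℝ (Fin n)) : ℝ :=
  (2 / Real.sqrt c) * arctanh (Real.sqrt c * ‖mobiusAdd c (-u) v‖)

theorem mobius_denom_pos {E : Type*} [NormedAddCommGroup E] [InnerProductSpace ℝ E]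
    {c : ℝ} (hc : 0 < c) {u v : E} (hu : c * ‖u‖ ^ 2 < 1) (hv : c * ‖v‖ ^ 2 < 1) :
    0 < 1 + 2 * c * ⟪u, v⟫ + c ^ 2 * ‖u‖ ^ 2 * ‖v‖ ^ 2 := by
  have h_inner : -(‖u‖ * ‖v‖) ≤ ⟪u, v⟫ := (abs_le.mp (abs_real_inner_le_norm u v)).1
  have h_prod : (c * ‖u‖ ^ 2) * (c * ‖v‖ ^ 2) < 1 :=
    mul_lt_one_of_nonneg_of_lt_one_left (by positivity) hu hv.le
  have h_lt : c * (‖u‖ * ‖v‖) < 1 := by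
    refine lt_of_pow_lt_pow_left₀ 2 zero_le_one ?_
    linarith
  have h_sq : 0 < (1 - c * (‖u‖ * ‖v‖)) ^ 2 := pow_pos (sub_pos.mpr h_lt) 2
  linarith [mul_le_mul_of_nonneg_left h_inner hc.le]

theorem mobius_norm_sq_numerator {E : Type*} [NormedAddCommGroup E] [InnerProductSpace ℝ E]
    (c : ℝ) (u v : E) :
    ‖(1 + 2 * c * ⟪u, v⟫ + c * ‖v‖ ^ 2) • u + (1 - c * ‖u‖ ^ 2) • v‖ ^ 2 =
      (1 + 2 * c * ⟪u, v⟫ + c ^ 2 * ‖u‖ ^ 2 * ‖v‖ ^ 2) * ‖u + v‖ ^ 2 := by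
  simp only [norm_add_sq_real, norm_smul, mul_pow, Real.norm_eq_abs, sq_abs,
    real_inner_smul_left, real_inner_smul_right]
  ring

theorem norm_mobiusAdd_sq {n : ℕ} {c : ℝ} {u v : EuclideanSpace ℝ (Fin n)}
    (h : 1 + 2 * c * ⟪u, v⟫ + c ^ 2 * ‖u‖ ^ 2 * ‖v‖ ^ 2 ≠ 0) :
    ‖mobiusAdd c u v‖ ^ 2 =
      ‖u + v‖ ^ 2 / (1 + 2 * c * ⟪u, v⟫ + c ^ 2 * ‖u‖ ^ 2 * ‖v‖ ^ 2) := by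
  rw [mobiusAdd, norm_smul, mul_pow, mobius_norm_sq_numerator, Real.norm_eq_abs, sq_abs]
  field_simp

theorem mobiusAdd_mem_ball {n : ℕ} (c : ℝ) (hc : 0 < c)
    (u v : EuclideanSpace ℝ (Fin n))
    (hu : c * ‖u‖ ^ 2 < 1) (hv : c * ‖v‖ ^ 2 < 1) :
    c * ‖mobiusAdd c u v‖ ^ 2 < 1 := by
  have h_pos := mobius_denom_pos hc hu hv
  rw [norm_mobiusAdd_sq h_pos.ne', ← mul_div_assoc, div_lt_one h_pos, norm_add_sq_real]
  linarith [mul_pos (sub_pos.mpr hu) (sub_pos.mpr hv)]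
end

section
/- (Proposition 1, inversion property.) For every c > 0, every reference point x' ∈ ℝⁿ with c‖x'‖² < 1, and every b ∈ ℝⁿ with c‖b‖² < 1 and b ≠ x', one has exp_{x'}^c(log_{x'}^c(b)) = b. -/
open scoped RealInnerProductSpace

/-- Conformal factor of the Poincaré ball at a point. -/
noncomputable def conformalFactor {n : ℕ} (c : ℝ) (x' : EuclideanSpace ℝ (Fin n)) : ℝ :=
  2 / (1 - c * ‖x'‖ ^ 2)

/-- Exponential map at a reference point of the Poincaré ball. -/
noncomputable def expMap {n : ℕ} (c : ℝ) (x' a : EuclideanSpace ℝ (Fin n)) :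
    EuclideanSpace ℝ (Fin n) :=
  mobiusAdd c x'
    ((Real.tanh (Real.sqrt c * conformalFactor c x' * ‖a‖ / 2) / (Real.sqrt c * ‖a‖)) • a)

/-- Logarithmic map at a reference point of the Poincaré ball. -/
noncomputable def logMap {n : ℕ} (c : ℝ) (x' b : EuclideanSpace ℝ (Fin n)) :
    EuclideanSpace ℝ (Fin n) :=
  ((2 / (Real.sqrt c * conformalFactor c x')) *
      arctanh (Real.sqrt c * ‖mobiusAdd c (-x') b‖) / ‖mobiusAdd c (-x') b‖) •
    mobiusAdd c (-x') b

theorem tanh_arctanh {y : ℝ} (hy : y ∈ Set.Ioo (-1) 1) : Real.tanh (arctanh y) = y := by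
  rw [arctanh, ← Real.artanh_eq_half_log (Set.Ioo_subset_Icc_self hy), Real.tanh_artanh hy]

theorem arctanh_pos {y : ℝ} (hy : y ∈ Set.Ioo 0 1) : 0 < arctanh y := by
  have h : 1 < (1 + y) / (1 - y) := by
    rw [one_lt_div (by linarith [hy.2])]
    linarith [hy.1]
  have := Real.log_pos h
  unfold arctanh
  positivity

section

variable {n : ℕ} {c : ℝ} {u v : EuclideanSpace ℝ (Fin n)}

theorem mobiusAdd_neg_denom_pos (hc : 0 < c) (hu : c * ‖u‖ ^ 2 < 1) (hv : c * ‖v‖ ^ 2 < 1) :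
    0 < 1 - 2 * c * ⟪u, v⟫ + c ^ 2 * ‖u‖ ^ 2 * ‖v‖ ^ 2 := by
  have hp : c * ⟪u, v⟫ ≤ c * (‖u‖ * ‖v‖) :=
    mul_le_mul_of_nonneg_left (real_inner_le_norm u v) hc.le
  have hlt : c * (‖u‖ * ‖v‖) < 1 := by nlinarith [mul_nonneg hc.le (sq_nonneg (‖u‖ - ‖v‖))]
  nlinarith [pow_pos (sub_pos.2 hlt) 2]

theorem mobiusAdd_neg_eq :
    mobiusAdd c (-u) v = (1 - 2 * c * ⟪u, v⟫ + c ^ 2 * ‖u‖ ^ 2 * ‖v‖ ^ 2)⁻¹ •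
      ((-(1 - 2 * c * ⟪u, v⟫ + c * ‖v‖ ^ 2)) • u + (1 - c * ‖u‖ ^ 2) • v) := by
  simp only [mobiusAdd, inner_neg_left, norm_neg, smul_neg, neg_smul, mul_neg, ← sub_eq_add_neg]

theorem inner_mobiusAdd_neg :
    ⟪u, mobiusAdd c (-u) v⟫ = (1 - 2 * c * ⟪u, v⟫ + c ^ 2 * ‖u‖ ^ 2 * ‖v‖ ^ 2)⁻¹ *
      (-(1 - 2 * c * ⟪u, v⟫ + c * ‖v‖ ^ 2) * ‖u‖ ^ 2 + (1 - c * ‖u‖ ^ 2) * ⟪u, v⟫) := by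
  rw [mobiusAdd_neg_eq, inner_smul_right, inner_add_right, inner_smul_right, inner_smul_right,
    real_inner_self_eq_norm_sq]

theorem norm_mobiusAdd_neg_sq
    (hD : 1 - 2 * c * ⟪u, v⟫ + c ^ 2 * ‖u‖ ^ 2 * ‖v‖ ^ 2 ≠ 0) :
    ‖mobiusAdd c (-u) v‖ ^ 2 = ‖v - u‖ ^ 2 /
      (1 - 2 * c * ⟪u, v⟫ + c ^ 2 * ‖u‖ ^ 2 * ‖v‖ ^ 2) := by
  rw [mobiusAdd_neg_eq, norm_smul, mul_pow, norm_add_sq_real, norm_sub_sq_real, norm_smul,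
    norm_smul, mul_pow, mul_pow, inner_smul_left, inner_smul_right, real_inner_comm u v]
  simp only [Real.norm_eq_abs, sq_abs, RCLike.conj_to_real]
  field_simp
  ring

/-- Left cancellation for Möbius addition. -/
theorem mobiusAdd_mobiusAdd_neg
    (hD : 1 - 2 * c * ⟪u, v⟫ + c ^ 2 * ‖u‖ ^ 2 * ‖v‖ ^ 2 ≠ 0) (hu : 1 - c * ‖u‖ ^ 2 ≠ 0) :
    mobiusAdd c u (mobiusAdd c (-u) v) = v := by
  have hE : 1 + 2 * c * ⟪u, mobiusAdd c (-u) v⟫ + c ^ 2 * ‖u‖ ^ 2 * ‖mobiusAdd c (-u) v‖ ^ 2 =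
      (1 - c * ‖u‖ ^ 2) ^ 2 / (1 - 2 * c * ⟪u, v⟫ + c ^ 2 * ‖u‖ ^ 2 * ‖v‖ ^ 2) := by
    rw [inner_mobiusAdd_neg, norm_mobiusAdd_neg_sq hD, norm_sub_sq_real, real_inner_comm u v]
    field_simp
    ring
  have hN : 1 + 2 * c * ⟪u, mobiusAdd c (-u) v⟫ + c * ‖mobiusAdd c (-u) v‖ ^ 2 =
      (1 - c * ‖u‖ ^ 2) * (1 - 2 * c * ⟪u, v⟫ + c * ‖v‖ ^ 2) /
        (1 - 2 * c * ⟪u, v⟫ + c ^ 2 * ‖u‖ ^ 2 * ‖v‖ ^ 2) := by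
    rw [inner_mobiusAdd_neg, norm_mobiusAdd_neg_sq hD, norm_sub_sq_real, real_inner_comm u v]
    field_simp
    ring
  rw [mobiusAdd, hE, hN, mobiusAdd_neg_eq]
  generalize 1 - 2 * c * ⟪u, v⟫ + c ^ 2 * ‖u‖ ^ 2 * ‖v‖ ^ 2 = D at hD ⊢
  match_scalars <;> field_simp
  ring

theorem mul_norm_mobiusAdd_neg_sq_lt_one (hc : 0 < c) (hu : c * ‖u‖ ^ 2 < 1)
    (hv : c * ‖v‖ ^ 2 < 1) : c * ‖mobiusAdd c (-u) v‖ ^ 2 < 1 := by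
  have hD := mobiusAdd_neg_denom_pos hc hu hv
  rw [norm_mobiusAdd_neg_sq hD.ne', norm_sub_sq_real, real_inner_comm u v, ← mul_div_assoc,
    div_lt_one hD]
  nlinarith [mul_pos (sub_pos.2 hu) (sub_pos.2 hv)]

end

theorem expMap_logMap {n : ℕ} (c : ℝ) (hc : 0 < c)
    (x' b : EuclideanSpace ℝ (Fin n))
    (hx' : c * ‖x'‖ ^ 2 < 1) (hb : c * ‖b‖ ^ 2 < 1) (hbx : b ≠ x') :
    expMap c x' (logMap c x' b) = b := by
  have hD := mobiusAdd_neg_denom_pos hc hx' hb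
  have hlt := mul_norm_mobiusAdd_neg_sq_lt_one hc hx' hb
  have hcancel := mobiusAdd_mobiusAdd_neg hD.ne' (sub_pos.2 hx').ne'
  have hw : 0 < ‖mobiusAdd c (-x') b‖ := by
    have hsub : 0 < ‖b - x'‖ := norm_pos_iff.2 (sub_ne_zero.2 hbx)
    have hsq : 0 < ‖mobiusAdd c (-x') b‖ ^ 2 := by
      rw [norm_mobiusAdd_neg_sq hD.ne']
      positivity
    exact (norm_nonneg _).lt_of_ne' fun h => by simp [h] at hsq
  have hs : 0 < √c := Real.sqrt_pos.2 hc
  have hl : 0 < conformalFactor c x' := div_pos two_pos (sub_pos.2 hx')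
  unfold expMap logMap
  set w := mobiusAdd c (-x') b
  have hy : √c * ‖w‖ ∈ Set.Ioo 0 1 := by
    refine ⟨by positivity, ?_⟩
    rw [← sq_lt_one_iff₀ (by positivity), mul_pow, Real.sq_sqrt hc.le]
    exact hlt
  have ht := arctanh_pos hy
  have hnorm : ‖(2 / (√c * conformalFactor c x') * arctanh (√c * ‖w‖) / ‖w‖) • w‖ =
      2 / (√c * conformalFactor c x') * arctanh (√c * ‖w‖) := by
    rw [norm_smul, Real.norm_of_nonneg (by positivity), div_mul_cancel₀ _ hw.ne']
  have harg : √c * conformalFactor c x' *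
      (2 / (√c * conformalFactor c x') * arctanh (√c * ‖w‖)) / 2 = arctanh (√c * ‖w‖) := by
    field_simp
  rw [hnorm, harg, tanh_arctanh ⟨by linarith [hy.1], hy.2⟩, smul_smul]
  convert hcancel using 2
  convert one_smul ℝ w using 2
  field_simp
end

section
/- For curvature c = 1, the arctanh form of the Poincaré distance coincides with the arccosh form: for all u, v ∈ ℝⁿ with ‖u‖ < 1 and ‖v‖ < 1, 2·arctanh(‖(−u) ⊕_1 v‖) = arccosh(1 + 2‖u − v‖² / ((1 − ‖u‖²)(1 − ‖v‖²))). -/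
open scoped RealInnerProductSpace

/-- Real inverse hyperbolic cosine. -/
noncomputable def arccosh (x : ℝ) : ℝ := Real.log (x + Real.sqrt (x ^ 2 - 1))

/-- The squared Möbius difference of two points, with the denominator cleared. -/
theorem norm_mobiusAdd_one_neg_sq {n : ℕ} {u v : EuclideanSpace ℝ (Fin n)}
    (hu : ‖u‖ < 1) (hv : ‖v‖ < 1) :
    ‖mobiusAdd 1 (-u) v‖ ^ 2 =
      ‖u - v‖ ^ 2 / (‖u - v‖ ^ 2 + (1 - ‖u‖ ^ 2) * (1 - ‖v‖ ^ 2)) := by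
  have hu' : 0 < 1 - ‖u‖ ^ 2 := by nlinarith [norm_nonneg u]
  have hv' : 0 < 1 - ‖v‖ ^ 2 := by nlinarith [norm_nonneg v]
  have hD : 0 < ‖u - v‖ ^ 2 + (1 - ‖u‖ ^ 2) * (1 - ‖v‖ ^ 2) := by positivity
  have key (x y : ℝ) : ‖x • (-u) + y • v‖ ^ 2 =
      x ^ 2 * ‖u‖ ^ 2 - 2 * x * y * ⟪u, v⟫ + y ^ 2 * ‖v‖ ^ 2 := by
    rw [norm_add_sq_real, norm_smul, norm_smul, norm_neg, inner_smul_left, inner_smul_right,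
      inner_neg_left, mul_pow, mul_pow, Real.norm_eq_abs, Real.norm_eq_abs, sq_abs, sq_abs]
    simp only [conj_trivial]
    ring
  rw [norm_sub_sq_real] at hD ⊢
  have hden : 1 + 2 * 1 * ⟪-u, v⟫ + 1 ^ 2 * ‖-u‖ ^ 2 * ‖v‖ ^ 2 =
      ‖u‖ ^ 2 - 2 * ⟪u, v⟫ + ‖v‖ ^ 2 + (1 - ‖u‖ ^ 2) * (1 - ‖v‖ ^ 2) := by
    rw [inner_neg_left, norm_neg]
    ring
  rw [mobiusAdd, hden, norm_smul, mul_pow, key, inner_neg_left, norm_neg, Real.norm_eq_abs,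
    sq_abs, inv_pow, inv_mul_eq_div, div_eq_div_iff (by positivity) hD.ne']
  ring

/-- The double-argument identity relating `arctanh` and `arccosh`. -/
theorem two_mul_arctanh_eq_arccosh {r : ℝ} (h0 : 0 ≤ r) (h1 : r < 1) :
    2 * arctanh r = arccosh ((1 + r ^ 2) / (1 - r ^ 2)) := by
  have hr : 0 < 1 - r := by linarith
  have hr2 : 0 < 1 - r ^ 2 := by nlinarith
  have hsq : ((1 + r ^ 2) / (1 - r ^ 2)) ^ 2 - 1 = (2 * r / (1 - r ^ 2)) ^ 2 := by
    field_simp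
    ring
  rw [arctanh, arccosh, hsq, Real.sqrt_sq (by positivity), ← mul_assoc, mul_one_div_cancel two_ne_zero,
    one_mul, ← add_div]
  congr 1
  rw [div_eq_div_iff hr.ne' hr2.ne']
  ring

theorem arctanh_eq_arccosh_form {n : ℕ} (u v : EuclideanSpace ℝ (Fin n))
    (hu : ‖u‖ < 1) (hv : ‖v‖ < 1) :
    2 * arctanh ‖mobiusAdd 1 (-u) v‖ =
      arccosh (1 + 2 * ‖u - v‖ ^ 2 / ((1 - ‖u‖ ^ 2) * (1 - ‖v‖ ^ 2))) := by
  have hu' : 0 < 1 - ‖u‖ ^ 2 := by nlinarith [norm_nonneg u]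
  have hv' : 0 < 1 - ‖v‖ ^ 2 := by nlinarith [norm_nonneg v]
  have hP : 0 < (1 - ‖u‖ ^ 2) * (1 - ‖v‖ ^ 2) := mul_pos hu' hv'
  have hm := norm_mobiusAdd_one_neg_sq hu hv
  have hlt : ‖mobiusAdd 1 (-u) v‖ < 1 := by
    rw [← sq_lt_one_iff₀ (norm_nonneg _), hm, div_lt_one (by positivity)]
    linarith
  rw [two_mul_arctanh_eq_arccosh (norm_nonneg _) hlt, hm]
  generalize (1 - ‖u‖ ^ 2) * (1 - ‖v‖ ^ 2) = P at hP ⊢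
  have hD : ‖u - v‖ ^ 2 + P ≠ 0 := by positivity
  congr 1
  rw [one_add_div hD, one_sub_div hD, div_div_div_cancel_right₀ hD, add_sub_cancel_left,
    one_add_div hP.ne']
  ring
end

section
/- The hyperbolic distance is strictly increasing in the curvature parameter: for all c₁, c₂ with 0 < c₁ < c₂ and all u, v ∈ ℝⁿ with u ≠ v, c₂‖u‖² < 1 and c₂‖v‖² < 1, one has d_{c₁}(u,v) < d_{c₂}(u,v). -/
open scoped RealInnerProductSpace

/-- The squared norm of the Möbius difference of two points. -/
lemma norm_sq_mobiusAdd_neg {n : ℕ} {c : ℝ} {u v : EuclideanSpace ℝ (Fin n)}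
    (h : (1 - c * ‖u‖ ^ 2) * (1 - c * ‖v‖ ^ 2) + c * ‖u - v‖ ^ 2 ≠ 0) :
    ‖mobiusAdd c (-u) v‖ ^ 2 =
      ‖u - v‖ ^ 2 / ((1 - c * ‖u‖ ^ 2) * (1 - c * ‖v‖ ^ 2) + c * ‖u - v‖ ^ 2) := by
  have hden : 1 + 2 * c * ⟪-u, v⟫ + c ^ 2 * ‖-u‖ ^ 2 * ‖v‖ ^ 2 =
      (1 - c * ‖u‖ ^ 2) * (1 - c * ‖v‖ ^ 2) + c * ‖u - v‖ ^ 2 := by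
    rw [norm_sub_sq_real, inner_neg_left, norm_neg]
    ring
  rw [mobiusAdd, hden, norm_smul, mul_pow, norm_inv, inv_pow, Real.norm_eq_abs, sq_abs,
    norm_add_sq_real, norm_smul, norm_smul, mul_pow, mul_pow, Real.norm_eq_abs, Real.norm_eq_abs,
    sq_abs, sq_abs, real_inner_smul_left, real_inner_smul_right, norm_neg, inner_neg_left,
    inv_mul_eq_div, div_eq_div_iff (pow_ne_zero 2 h) h, norm_sub_sq_real]
  ring

lemma arctanh_eq_arsinh {x : ℝ} (hx₀ : 0 ≤ x) (hx₁ : x < 1) :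
    arctanh x = Real.arsinh √(x ^ 2 / (1 - x ^ 2)) := by
  have hx : x ∈ Set.Ioo (-1) 1 := ⟨by linarith, hx₁⟩
  rw [arctanh, ← Real.artanh_eq_half_log (Set.Ioo_subset_Icc_self hx),
    Real.sqrt_div (sq_nonneg x), Real.sqrt_sq hx₀, ← Real.sinh_artanh hx, Real.arsinh_sinh]

/-- The hyperbolic distance in terms of the inverse hyperbolic sine. -/
lemma hypDist_eq_arsinh {n : ℕ} {c : ℝ} (hc : 0 < c) {u v : EuclideanSpace ℝ (Fin n)}
    (hu : c * ‖u‖ ^ 2 < 1) (hv : c * ‖v‖ ^ 2 < 1) :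
    hypDist c u v = 2 * (Real.arsinh (√c * ‖u - v‖ /
      √((1 - √c ^ 2 * ‖u‖ ^ 2) * (1 - √c ^ 2 * ‖v‖ ^ 2))) / √c) := by
  rw [Real.sq_sqrt hc.le]
  have hP : 0 < (1 - c * ‖u‖ ^ 2) * (1 - c * ‖v‖ ^ 2) :=
    mul_pos (sub_pos.2 hu) (sub_pos.2 hv)
  have hE : 0 < (1 - c * ‖u‖ ^ 2) * (1 - c * ‖v‖ ^ 2) + c * ‖u - v‖ ^ 2 := by positivity
  have hx : (√c * ‖mobiusAdd c (-u) v‖) ^ 2 =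
      c * ‖u - v‖ ^ 2 / ((1 - c * ‖u‖ ^ 2) * (1 - c * ‖v‖ ^ 2) + c * ‖u - v‖ ^ 2) := by
    rw [mul_pow, Real.sq_sqrt hc.le, norm_sq_mobiusAdd_neg hE.ne', mul_div_assoc]
  have hx₁ : √c * ‖mobiusAdd c (-u) v‖ < 1 := by
    rw [← sq_lt_one_iff₀ (by positivity), hx, div_lt_one hE]
    linarith
  rw [hypDist, arctanh_eq_arsinh (by positivity) hx₁, hx]
  have hq : c * ‖u - v‖ ^ 2 / ((1 - c * ‖u‖ ^ 2) * (1 - c * ‖v‖ ^ 2) + c * ‖u - v‖ ^ 2) /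
      (1 - c * ‖u - v‖ ^ 2 / ((1 - c * ‖u‖ ^ 2) * (1 - c * ‖v‖ ^ 2) + c * ‖u - v‖ ^ 2)) =
      c * ‖u - v‖ ^ 2 / ((1 - c * ‖u‖ ^ 2) * (1 - c * ‖v‖ ^ 2)) := by
    rw [one_sub_div hE.ne', add_sub_cancel_right, div_div_div_cancel_right₀ hE.ne']
  rw [hq, Real.sqrt_div (by positivity), Real.sqrt_mul hc.le, Real.sqrt_sq (norm_nonneg _)]
  ring

lemma arsinh_lt_self {x : ℝ} (hx : 0 < x) : Real.arsinh x < x := by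
  conv_rhs => rw [← Real.arsinh_sinh x]
  exact Real.arsinh_lt_arsinh.2 (Real.self_lt_sinh_iff.2 hx)

lemma hasDerivAt_mul_div_sqrt {p r d s : ℝ} (hQ : 0 < (1 - s ^ 2 * p ^ 2) * (1 - s ^ 2 * r ^ 2)) :
    HasDerivAt (fun t : ℝ => t * d / √((1 - t ^ 2 * p ^ 2) * (1 - t ^ 2 * r ^ 2)))
      (d / √((1 - s ^ 2 * p ^ 2) * (1 - s ^ 2 * r ^ 2)) *
        ((1 - (s * p * (s * r)) ^ 2) / ((1 - s ^ 2 * p ^ 2) * (1 - s ^ 2 * r ^ 2)))) s := by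
  have h (a : ℝ) : HasDerivAt (fun t : ℝ => 1 - t ^ 2 * a ^ 2) (-(2 * s * a ^ 2)) s := by
    simpa using (((hasDerivAt_pow 2 s).mul_const (a ^ 2)).const_sub 1)
  have hR := Real.sqrt_pos.2 hQ
  have hR2 := Real.sq_sqrt hQ.le
  refine (((hasDerivAt_id s).mul_const d).div (((h p).mul (h r)).sqrt hQ.ne')
    hR.ne').congr_deriv ?_
  simp only [Pi.mul_apply, id]
  generalize √((1 - s ^ 2 * p ^ 2) * (1 - s ^ 2 * r ^ 2)) = R at hR hR2 ⊢
  rw [← hR2]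
  field_simp
  rw [hR2]
  ring

/-- In terms of `s = √c`, half the hyperbolic distance between two points of norms `p` and `r` at
Euclidean distance `d` is strictly increasing. -/
lemma strictMonoOn_arsinh_div {p r d : ℝ} (hp : 0 ≤ p) (hr : 0 ≤ r) (hd : 0 < d)
    (hdpr : d ≤ p + r) {s₁ s₂ : ℝ} (hs₁ : 0 < s₁) (hsp : s₂ ^ 2 * p ^ 2 < 1)
    (hsr : s₂ ^ 2 * r ^ 2 < 1) :
    StrictMonoOn (fun t : ℝ =>
      Real.arsinh (t * d / √((1 - t ^ 2 * p ^ 2) * (1 - t ^ 2 * r ^ 2))) / t)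
      (Set.Icc s₁ s₂) := by
  have key : ∀ s ∈ Set.Icc s₁ s₂, ∃ y, 0 < y ∧ HasDerivAt (fun t : ℝ =>
      Real.arsinh (t * d / √((1 - t ^ 2 * p ^ 2) * (1 - t ^ 2 * r ^ 2))) / t) y s := by
    rintro s ⟨h₁, h₂⟩
    have hs : 0 < s := hs₁.trans_le h₁
    have hA : s ^ 2 * p ^ 2 < 1 := lt_of_le_of_lt (by gcongr) hsp
    have hB : s ^ 2 * r ^ 2 < 1 := lt_of_le_of_lt (by gcongr) hsr
    have hQ : 0 < (1 - s ^ 2 * p ^ 2) * (1 - s ^ 2 * r ^ 2) :=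
      mul_pos (sub_pos.2 hA) (sub_pos.2 hB)
    have hder := hasDerivAt_mul_div_sqrt (d := d) hQ
    have hR := Real.sqrt_pos.2 hQ
    have hR2 := Real.sq_sqrt hQ.le
    refine ⟨_, ?_, hder.arsinh.div (hasDerivAt_id s) hs.ne'⟩
    have hAB : (s * p * (s * r)) ^ 2 ≤ 1 := by
      calc (s * p * (s * r)) ^ 2 = (s ^ 2 * p ^ 2) * (s ^ 2 * r ^ 2) := by ring
        _ ≤ 1 := mul_le_one₀ hA.le (by positivity) hB.le
    set Q := (1 - s ^ 2 * p ^ 2) * (1 - s ^ 2 * r ^ 2) with hQdef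
    have hq : 0 < s * d / √Q := by positivity
    have hsqrt : √(1 + (s * d / √Q) ^ 2) ≤ (1 - (s * p * (s * r)) ^ 2) / Q := by
      refine Real.sqrt_le_iff.2 ⟨div_nonneg (sub_nonneg.2 hAB) hQ.le, ?_⟩
      have hsum : Q + (s * d) ^ 2 ≤ (1 + s * p * (s * r)) ^ 2 := by
        have : (s * d) ^ 2 ≤ (s * (p + r)) ^ 2 := by gcongr
        nlinarith
      have hdiff : Q ≤ (1 - s * p * (s * r)) ^ 2 := by
        nlinarith [sq_nonneg (s * p - s * r)]
      calc 1 + (s * d / √Q) ^ 2 = (Q + (s * d) ^ 2) * Q / Q ^ 2 := by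
            rw [div_pow, hR2]; field_simp
        _ ≤ (1 + s * p * (s * r)) ^ 2 * (1 - s * p * (s * r)) ^ 2 / Q ^ 2 := by gcongr
        _ = ((1 - (s * p * (s * r)) ^ 2) / Q) ^ 2 := by rw [div_pow]; ring
    have hS : 0 < √(1 + (s * d / √Q) ^ 2) := by positivity
    have hlow : s * d / √Q ≤ (√(1 + (s * d / √Q) ^ 2))⁻¹ *
        (d / √Q * ((1 - (s * p * (s * r)) ^ 2) / Q)) * s := by
      calc s * d / √Q = (√(1 + (s * d / √Q) ^ 2))⁻¹ *
            (d / √Q * √(1 + (s * d / √Q) ^ 2)) * s := by field_simp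
        _ ≤ _ := by gcongr
    have hlt := arsinh_lt_self hq
    simp only [smul_eq_mul, mul_one]
    exact div_pos (sub_pos.2 (hlt.trans_le hlow)) (by positivity)
  refine strictMonoOn_of_deriv_pos (convex_Icc _ _) (fun s hs => ?_) (fun s hs => ?_)
  · obtain ⟨y, -, hy⟩ := key s hs
    exact hy.continuousAt.continuousWithinAt
  · obtain ⟨y, hpos, hy⟩ := key s (interior_subset hs)
    rwa [hy.deriv]

theorem hypDist_strictMono_curvature {n : ℕ} (c₁ c₂ : ℝ) (hc₁ : 0 < c₁) (hc : c₁ < c₂)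
    (u v : EuclideanSpace ℝ (Fin n)) (huv : u ≠ v)
    (hu : c₂ * ‖u‖ ^ 2 < 1) (hv : c₂ * ‖v‖ ^ 2 < 1) :
    hypDist c₁ u v < hypDist c₂ u v := by
  have hc₂ : 0 < c₂ := hc₁.trans hc
  have hlt : √c₁ < √c₂ := Real.sqrt_lt_sqrt hc₁.le hc
  rw [hypDist_eq_arsinh hc₁ (lt_of_le_of_lt (by gcongr) hu) (lt_of_le_of_lt (by gcongr) hv),
    hypDist_eq_arsinh hc₂ hu hv]
  refine mul_lt_mul_of_pos_left ?_ two_pos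
  exact strictMonoOn_arsinh_div (norm_nonneg u) (norm_nonneg v) (norm_pos_iff.2 (sub_ne_zero.2 huv))
    (norm_sub_le u v) (Real.sqrt_pos.2 hc₁) (by rwa [Real.sq_sqrt hc₂.le])
    (by rwa [Real.sq_sqrt hc₂.le]) (Set.left_mem_Icc.2 hlt.le) (Set.right_mem_Icc.2 hlt.le) hlt
end

section
/- The hyperbolic distance degenerates to (twice) the Euclidean distance as the curvature parameter tends to 0: for all fixed u, v ∈ ℝⁿ, the function c ↦ d_c(u,v) = (2/√c)·arctanh(√c·‖(−u) ⊕_c v‖) tends to 2‖u − v‖ as c → 0 from the right (limit along the filter 𝓝[>] 0). -/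
open scoped RealInnerProductSpace

theorem hasDerivAt_arctanh_zero : HasDerivAt arctanh 1 0 := by
  have hquot : HasDerivAt (fun x : ℝ => (1 + x) / (1 - x)) 2 0 := by
    have h := ((hasDerivAt_id' (0 : ℝ)).const_add 1).fun_div ((hasDerivAt_id' (0 : ℝ)).const_sub 1)
      (by norm_num)
    norm_num at h
    exact h
  have hlog := (hquot.log (by norm_num)).const_mul (1 / 2 : ℝ)
  norm_num at hlog
  refine hlog.congr_of_eventuallyEq (.of_forall fun x => ?_)
  simp [arctanh]

theorem arctanh_eq_mul_dslope (x : ℝ) : arctanh x = x * dslope arctanh 0 x := by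
  have h := sub_smul_dslope arctanh 0 x
  simpa [arctanh] using h.symm

theorem tendsto_dslope_arctanh_zero :
    Filter.Tendsto (dslope arctanh 0) (nhds 0) (nhds 1) := by
  have h : ContinuousAt (dslope arctanh 0) 0 :=
    continuousAt_dslope_same.2 hasDerivAt_arctanh_zero.differentiableAt
  simpa [ContinuousAt, hasDerivAt_arctanh_zero.deriv] using h

theorem tendsto_mobiusAdd_zero {n : ℕ} (u v : EuclideanSpace ℝ (Fin n)) :
    Filter.Tendsto (fun c : ℝ => mobiusAdd c u v) (nhds 0) (nhds (u + v)) := by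
  have h : ContinuousAt (fun c : ℝ => mobiusAdd c u v) 0 := by
    unfold mobiusAdd
    apply ContinuousAt.fun_smul
    · exact ContinuousAt.inv₀ (by fun_prop) (by simp)
    · fun_prop
  simpa [ContinuousAt, mobiusAdd] using h

theorem hypDist_tendsto_euclidean {n : ℕ} (u v : EuclideanSpace ℝ (Fin n)) :
    Filter.Tendsto (fun c : ℝ => hypDist c u v) (nhdsWithin 0 (Set.Ioi 0))
      (nhds (2 * ‖u - v‖)) := by
  have hnorm : Filter.Tendsto (fun c : ℝ => ‖mobiusAdd c (-u) v‖) (nhds 0)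
      (nhds ‖u - v‖) := by
    simpa [neg_add_eq_sub, norm_sub_rev v u] using (tendsto_mobiusAdd_zero (-u) v).norm
  have harg : Filter.Tendsto (fun c : ℝ => √c * ‖mobiusAdd c (-u) v‖) (nhds 0) (nhds 0) := by
    simpa using (Real.continuous_sqrt.tendsto 0).mul hnorm
  have hlim := (hnorm.const_mul 2).mul (tendsto_dslope_arctanh_zero.comp harg)
  rw [mul_one] at hlim
  refine (hlim.mono_left nhdsWithin_le_nhds).congr' ?_
  filter_upwards [self_mem_nhdsWithin] with c hc
  have hsqrt : √c ≠ 0 := (Real.sqrt_pos.2 hc).ne'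
  rw [hypDist, arctanh_eq_mul_dslope, Function.comp_apply]
  field_simp
end
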